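/- Let x_{2,2} be the largest zero of V'' in (0,∞) and let V₀(x) = 2·h₀(x)² − 2·μ₀² − V(x) with h₀ = φ₀'/φ₀. Then for all x ≥ x_{2,2} one has 3·V'(x) ≤ V₀'(x) ≤ (1/2)·V'(x); in particular V₀'(x) < 0 for such x, and V₀' decays at the same rate as V' at infinity. -/

import Mathlib

open Real MeasureTheory Filter

noncomputable def Qs (x : ℝ) : ℝ := (3/2) * (1 / Real.cosh (x/2))^2
noncomputable def Hs (x : ℝ) : ℝ := Real.tanh (x/2)
noncomputable def alphaFn (x : ℝ) : ℝ := (1/3) * (Real.sinh x + x)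
noncomputable def alphaInv : ℝ → ℝ := Function.invFun alphaFn
noncomputable def Qt (x : ℝ) : ℝ := Qs (alphaInv x)
noncomputable def Ht (x : ℝ) : ℝ := Hs (alphaInv x)
noncomputable def Vpot (x : ℝ) : ℝ := 2 * (Qt x)^2 * (1 - Qt x)

lemma sq_Hs (s : ℝ) : Hs s ^ 2 = 1 - 2 / 3 * Qs s := by
  have hc := (Real.cosh_pos (s / 2)).ne'
  have h := Real.cosh_sq (s / 2)
  unfold Hs Qs
  rw [Real.tanh_eq_sinh_div_cosh]
  field_simp
  linarith

lemma Qs_pos (s : ℝ) : 0 < Qs s := by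
  have := Real.cosh_pos (s / 2)
  unfold Qs
  positivity

lemma Qs_mul_cosh (s : ℝ) : Qs s * (Real.cosh s + 1) = 3 := by
  have hc := (Real.cosh_pos (s / 2)).ne'
  have h2 : Real.cosh s = 2 * Real.cosh (s / 2) ^ 2 - 1 := by
    have h := Real.cosh_two_mul (s / 2)
    rw [Real.sinh_sq, mul_div_cancel₀ s two_ne_zero] at h
    linarith
  unfold Qs
  rw [h2]
  field_simp
  ring

lemma hasDerivAt_Hs (s : ℝ) : HasDerivAt Hs (Qs s / 3) s := by
  have hc := (Real.cosh_pos (s / 2)).ne'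
  have e : Hs = fun x => Real.sinh (x / 2) / Real.cosh (x / 2) := by
    funext x
    exact Real.tanh_eq_sinh_div_cosh _
  have hd : HasDerivAt (fun x : ℝ => x / 2) (1 / 2) s := (hasDerivAt_id s).div_const 2
  rw [e]
  refine HasDerivAt.congr_deriv (hd.sinh.div hd.cosh hc) ?_
  have h := Real.cosh_sq (s / 2)
  unfold Qs
  field_simp
  linarith

lemma hasDerivAt_Qs (s : ℝ) : HasDerivAt Qs (-(Hs s * Qs s)) s := by
  have e : Qs = fun x => 3 / 2 * (1 - Hs x ^ 2) := by
    funext x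
    rw [sq_Hs]
    ring
  have h := (((hasDerivAt_Hs s).pow 2).const_sub 1).const_mul (3 / 2 : ℝ)
  rw [show (fun y => 3 / 2 * (1 - (Hs ^ 2) y)) = Qs from e.symm] at h
  refine HasDerivAt.congr_deriv (h) ?_
  norm_num
  ring

lemma hasDerivAt_alphaFn (s : ℝ) : HasDerivAt alphaFn (Qs s)⁻¹ s := by
  have h := ((Real.hasDerivAt_sinh s).add (hasDerivAt_id s)).const_mul (1 / 3 : ℝ)
  refine HasDerivAt.congr_deriv (h) ?_
  have h1 := Qs_mul_cosh s
  have h2 := (Qs_pos s).ne'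
  field_simp
  linarith

lemma strictMono_alphaFn : StrictMono alphaFn := fun a b hab => by
  have := Real.sinh_strictMono hab
  unfold alphaFn
  linarith

lemma alphaFn_surjective : Function.Surjective alphaFn := by
  have hc : Continuous alphaFn := by
    unfold alphaFn
    fun_prop
  refine hc.surjective ?_ ?_
  · refine tendsto_atTop_mono' atTop ?_
      (tendsto_id.const_mul_atTop (show (0 : ℝ) < 1 / 3 by norm_num))
    filter_upwards [eventually_ge_atTop 0] with x hx
    have := Real.sinh_nonneg_iff.2 hx
    simp only [alphaFn, id]
    linarith
  · refine tendsto_atBot_mono' atBot ?_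
      (tendsto_id.const_mul_atBot (show (0 : ℝ) < 1 / 3 by norm_num))
    filter_upwards [eventually_le_atBot 0] with x hx
    have := Real.sinh_nonpos_iff.2 hx
    simp only [alphaFn, id]
    linarith

lemma alphaInv_alphaFn (s : ℝ) : alphaInv (alphaFn s) = s :=
  Function.leftInverse_invFun strictMono_alphaFn.injective s

lemma alphaFn_alphaInv (x : ℝ) : alphaFn (alphaInv x) = x :=
  Function.rightInverse_invFun alphaFn_surjective x

lemma alphaInv_mono : Monotone alphaInv := fun a b hab => by
  rw [← strictMono_alphaFn.le_iff_le, alphaFn_alphaInv, alphaFn_alphaInv]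
  exact hab

lemma alphaInv_nonneg {x : ℝ} (hx : 0 ≤ x) : 0 ≤ alphaInv x := by
  rw [← strictMono_alphaFn.le_iff_le, alphaFn_alphaInv]
  simpa [alphaFn] using hx

lemma alphaInv_pos {x : ℝ} (hx : 0 < x) : 0 < alphaInv x := by
  rw [← strictMono_alphaFn.lt_iff_lt, alphaFn_alphaInv]
  simpa [alphaFn] using hx

lemma hasDerivAt_alphaInv (x : ℝ) : HasDerivAt alphaInv (Qt x) x := by
  have hc : Continuous alphaInv :=
    alphaInv_mono.continuous_of_surjective fun s => ⟨alphaFn s, alphaInv_alphaFn s⟩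
  have h := (hasDerivAt_alphaFn (alphaInv x)).of_local_left_inverse hc.continuousAt
    (inv_ne_zero (Qs_pos _).ne') (Eventually.of_forall alphaFn_alphaInv)
  simpa [Qt] using h

lemma Qt_pos (x : ℝ) : 0 < Qt x := Qs_pos _

lemma sq_Ht (x : ℝ) : Ht x ^ 2 = 1 - 2 / 3 * Qt x := sq_Hs _

lemma Ht_pos {x : ℝ} (hx : 0 < x) : 0 < Ht x := by
  have := alphaInv_pos hx
  unfold Ht Hs
  rw [Real.tanh_eq_sinh_div_cosh]
  exact div_pos (Real.sinh_pos_iff.2 (by linarith)) (Real.cosh_pos _)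

lemma hasDerivAt_Qt (x : ℝ) : HasDerivAt Qt (-(Ht x * Qt x ^ 2)) x := by
  refine HasDerivAt.congr_deriv ((hasDerivAt_Qs (alphaInv x)).comp x (hasDerivAt_alphaInv x)) ?_
  unfold Ht Qt
  ring

lemma hasDerivAt_Ht (x : ℝ) : HasDerivAt Ht (Qt x ^ 2 / 3) x := by
  refine HasDerivAt.congr_deriv ((hasDerivAt_Hs (alphaInv x)).comp x (hasDerivAt_alphaInv x)) ?_
  unfold Qt
  ring

lemma hasDerivAt_Vpot (x : ℝ) :
    HasDerivAt Vpot (-(2 * Ht x * Qt x ^ 3 * (2 - 3 * Qt x))) x := by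
  have hq := hasDerivAt_Qt x
  refine HasDerivAt.congr_deriv (((hq.pow 2).const_mul 2).mul (hq.const_sub 1)) ?_
  norm_num
  ring

lemma deriv_Vpot :
    deriv Vpot = fun x => -(2 * Ht x * Qt x ^ 3 * (2 - 3 * Qt x)) :=
  funext fun x => (hasDerivAt_Vpot x).deriv

lemma hasDerivAt_deriv_Vpot (x : ℝ) :
    HasDerivAt (deriv Vpot) (2 / 3 * Qt x ^ 4 * (27 * Qt x ^ 2 - 50 * Qt x + 18)) x := by
  have hq := hasDerivAt_Qt x
  rw [deriv_Vpot]
  refine HasDerivAt.congr_deriv (((((hasDerivAt_Ht x).const_mul 2).mul (hq.pow 3)).mul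
    ((hq.const_mul 3).const_sub 2)).neg) ?_
  have hH := sq_Ht x
  norm_num
  linear_combination (12 * Qt x ^ 4 - 24 * Qt x ^ 5) * hH

lemma Qt_antitoneOn : AntitoneOn Qt (Set.Ici 0) := fun a ha b _ hab => by
  have h1 := alphaInv_nonneg ha
  have h2 := alphaInv_mono hab
  have h3 : Real.cosh (alphaInv a) ≤ Real.cosh (alphaInv b) := by
    rw [Real.cosh_le_cosh, abs_of_nonneg h1, abs_of_nonneg (h1.trans h2)]
    exact h2
  have ha' := Qs_mul_cosh (alphaInv a)
  have hb' := Qs_mul_cosh (alphaInv b)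
  have := Real.cosh_pos (alphaInv a)
  have := Qs_pos (alphaInv b)
  unfold Qt
  by_contra! hlt
  nlinarith

lemma Qt_le_two_div {x : ℝ} (hx : 0 < x) : Qt x ≤ 2 / x := by
  rw [le_div_iff₀ hx]
  have h1 := alphaFn_alphaInv x
  have h2 := Qs_mul_cosh (alphaInv x)
  have h3 := Real.self_le_sinh_iff.2 (alphaInv_nonneg hx.le)
  have h4 := Real.sinh_lt_cosh (alphaInv x)
  have h5 : x ≤ 2 / 3 * (Real.cosh (alphaInv x) + 1) := by
    unfold alphaFn at h1
    linarith
  have h6 := mul_le_mul_of_nonneg_left h5 (Qs_pos (alphaInv x)).le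
  unfold Qt
  linarith

lemma tendsto_Qt : Tendsto Qt atTop (nhds 0) := by
  refine squeeze_zero' (Eventually.of_forall fun x => (Qt_pos x).le) ?_
    (tendsto_const_nhds.div_atTop tendsto_id : Tendsto (fun x : ℝ => 2 / id x) atTop (nhds 0))
  filter_upwards [eventually_gt_atTop 0] with x hx
  exact Qt_le_two_div hx

lemma tendsto_Vpot : Tendsto Vpot atTop (nhds 0) := by
  have h := ((tendsto_Qt.pow 2).const_mul 2).mul (tendsto_Qt.const_sub 1)
  convert h using 1
  · rfl
  · simp

lemma tendsto_deriv_Vpot : Tendsto (deriv Vpot) atTop (nhds 0) := by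
  have h0 : Tendsto (fun x => 2 * Qt x ^ 3 * |2 - 3 * Qt x|) atTop (nhds 0) := by
    have h := ((tendsto_Qt.pow 3).const_mul 2).mul ((tendsto_Qt.const_mul 3).const_sub 2).abs
    simpa using h
  refine squeeze_zero_norm (fun x => ?_) h0
  have hH : |Ht x| ≤ 1 := by
    rw [← sq_le_one_iff_abs_le_one, sq_Ht]
    linarith [Qt_pos x]
  have hq := Qt_pos x
  rw [deriv_Vpot, Real.norm_eq_abs, abs_neg, abs_mul, abs_mul, abs_mul, abs_of_pos (pow_pos hq 3),
    abs_of_pos (two_pos : (0 : ℝ) < 2)]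
  have h1 : 0 ≤ Qt x ^ 3 * |2 - 3 * Qt x| := by positivity
  nlinarith

lemma exists_pos_Qt_eq {r : ℝ} (h0 : 0 < r) (h1 : r < 3 / 2) : ∃ y, 0 < y ∧ Qt y = r := by
  have hr : 0 < 3 / (2 * r) - 1 := by
    rw [sub_pos, lt_div_iff₀ (by positivity)]
    linarith
  set t := Real.arsinh √(3 / (2 * r) - 1) with ht
  have htpos : 0 < t := Real.arsinh_pos_iff.2 (Real.sqrt_pos.2 hr)
  refine ⟨alphaFn (2 * t), ?_, ?_⟩
  · have := Real.sinh_pos_iff.2 (show 0 < 2 * t by linarith)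
    unfold alphaFn
    positivity
  · have hc : Real.cosh t ^ 2 = 3 / (2 * r) := by
      rw [Real.cosh_sq, ht, Real.sinh_arsinh, Real.sq_sqrt hr.le]
      ring
    unfold Qt Qs
    rw [alphaInv_alphaFn, mul_div_cancel_left₀ t two_ne_zero, div_pow, hc]
    field_simp

lemma Qt_largest_inflection {a : ℝ} (ha : 0 < a) (hzero : deriv (deriv Vpot) a = 0)
    (hmax : ∀ y : ℝ, 0 < y → deriv (deriv Vpot) y = 0 → y ≤ a) :
    27 * Qt a ^ 2 - 50 * Qt a + 18 = 0 ∧ Qt a < 0.49 := by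
  have hquad : 27 * Qt a ^ 2 - 50 * Qt a + 18 = 0 := by
    have := Qt_pos a
    rw [(hasDerivAt_deriv_Vpot a).deriv] at hzero
    exact (mul_eq_zero.1 hzero).resolve_left (by positivity)
  refine ⟨hquad, ?_⟩
  have hs := Real.sq_sqrt (show (0 : ℝ) ≤ 139 by norm_num)
  have hs0 := Real.sqrt_nonneg (139 : ℝ)
  have hs1 : (11.78 : ℝ) < √139 := by nlinarith
  have hs2 : √139 < (12 : ℝ) := by nlinarith
  obtain ⟨y, hy, hQ⟩ := exists_pos_Qt_eq (r := (25 - √139) / 27) (by linarith) (by linarith)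
  have hya : y ≤ a := by
    refine hmax y hy ?_
    rw [(hasDerivAt_deriv_Vpot y).deriv, hQ]
    refine mul_eq_zero_of_right _ ?_
    linear_combination hs / 27
  have := Qt_antitoneOn hy.le ha.le hya
  linarith

/-- A function vanishing at infinity which does not increase wherever it is negative
is nonnegative. -/
lemma nonneg_of_tendsto_zero_of_deriv_nonpos {f f' : ℝ → ℝ} {a : ℝ}
    (hf : ∀ x, a ≤ x → HasDerivAt f (f' x) x)
    (hneg : ∀ x, a ≤ x → f x < 0 → f' x ≤ 0)
    (hlim : Tendsto f atTop (nhds 0)) {x : ℝ} (hx : a ≤ x) : 0 ≤ f x := by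
  by_contra! hlt
  have key : ∀ y, x ≤ y → f y ≤ f x / 2 := by
    intro y hxy
    have hd : 0 < 2 * (y - x) + 1 := by linarith
    set ε := -f x / (2 * (y - x) + 1) with hε
    have hεpos : 0 < ε := div_pos (by linarith) hd
    have hεeq : ε * (2 * (y - x) + 1) = -f x := div_mul_cancel₀ _ hd.ne'
    have hB : ∀ t, HasDerivAt (fun t => f x + ε * (t - x)) ε t := fun t => by
      simpa using (((hasDerivAt_id t).sub_const x).const_mul ε).const_add (f x)
    have h := image_le_of_deriv_right_lt_deriv_boundary (f := f) (f' := f') (a := x) (b := y)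
      (fun t ht => (hf t (hx.trans ht.1)).continuousAt.continuousWithinAt)
      (fun t ht => (hf t (hx.trans ht.1)).hasDerivWithinAt)
      (B := fun t => f x + ε * (t - x)) (B' := fun _ => ε) (by simp) hB
      (fun t ht he => by
        have : ε * (t - x) ≤ ε * (y - x) := by
          have := ht.2
          gcongr
        have := hneg t (hx.trans ht.1) (by rw [he]; linarith)
        linarith)
      (Set.right_mem_Icc.2 hxy)
    linarith
  have := ge_of_tendsto' (hlim.comp (tendsto_const_nhds.add_atTop tendsto_id :
    Tendsto (fun t => x + id t) atTop atTop) |>.comp tendsto_natCast_atTop_atTop |>.const_sub 0)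
    (b := -f x / 2) (fun n => by
      have := key (x + n) (by simp)
      simp only [Function.comp, id]
      linarith)
  linarith

/-- The logarithmic derivative `h` of a positive solution of `φ'' = (V + μ²) φ` decaying at
infinity satisfies `h ≤ -μ` and `0 ≤ h'` where `V` is nonnegative and nonincreasing. -/
lemma log_deriv_bounds_of_decay {φ φ' V V' : ℝ → ℝ} {μ a : ℝ} (hμ : 0 < μ)
    (hφ : ∀ x, HasDerivAt φ (φ' x) x) (hφ' : ∀ x, HasDerivAt φ' ((V x + μ ^ 2) * φ x) x)
    (hpos : ∀ x, 0 < φ x) (hlim : Tendsto φ atTop (nhds 0)) (hlim' : Tendsto φ' atTop (nhds 0))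
    (hV : ∀ x, HasDerivAt V (V' x) x) (hV0 : ∀ x, a ≤ x → 0 ≤ V x)
    (hV' : ∀ x, a ≤ x → V' x ≤ 0) (hVlim : Tendsto V atTop (nhds 0)) {x : ℝ} (hx : a ≤ x) :
    φ' x / φ x ≤ -μ ∧ 0 ≤ V x + μ ^ 2 - (φ' x / φ x) ^ 2 := by
  set h := fun x => φ' x / φ x with hh
  have hder : ∀ x, HasDerivAt h (V x + μ ^ 2 - h x ^ 2) x := fun x => by
    have hne := (hpos x).ne'
    refine HasDerivAt.congr_deriv ((hφ' x).div (hφ x) hne) ?_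
    simp only [hh]
    field_simp
  have hg : ∀ x, a ≤ x → 0 ≤ V x + μ ^ 2 - h x ^ 2 := by
    intro x hx
    have hG : 0 ≤ (V x + μ ^ 2) * φ x ^ 2 - φ' x ^ 2 := by
      refine nonneg_of_tendsto_zero_of_deriv_nonpos (a := a)
        (f := fun x => (V x + μ ^ 2) * φ x ^ 2 - φ' x ^ 2) (f' := fun x => V' x * φ x ^ 2)
        (fun y _ => ?_) (fun y hy _ => mul_nonpos_of_nonpos_of_nonneg (hV' y hy) (sq_nonneg _))
        ?_ hx
      · refine HasDerivAt.congr_deriv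
          ((((hV y).add_const (μ ^ 2)).mul ((hφ y).pow 2)).sub ((hφ' y).pow 2)) ?_
        norm_num
        ring
      · simpa using ((hVlim.add_const (μ ^ 2)).mul (hlim.pow 2)).sub (hlim'.pow 2)
    have hne := (hpos x).ne'
    have e : V x + μ ^ 2 - h x ^ 2 = ((V x + μ ^ 2) * φ x ^ 2 - φ' x ^ 2) / φ x ^ 2 := by
      simp only [hh]
      field_simp
    rw [e]
    positivity
  have hmono : MonotoneOn h (Set.Ici a) :=
    monotoneOn_of_hasDerivWithinAt_nonneg (convex_Ici a)
      (fun y _ => (hder y).continuousAt.continuousWithinAt)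
      (fun y _ => (hder y).hasDerivWithinAt) (fun y hy => hg y (interior_subset hy))
  have hneg : ∀ x, a ≤ x → h x < 0 := by
    intro x hx
    by_contra! hnn
    have hφmono : MonotoneOn φ (Set.Ici x) :=
      monotoneOn_of_hasDerivWithinAt_nonneg (convex_Ici x)
        (fun y _ => (hφ y).continuousAt.continuousWithinAt)
        (fun y _ => (hφ y).hasDerivWithinAt) (fun y hy => by
          have hxy : x ≤ y := interior_subset hy
          have := hnn.trans (hmono hx (hx.trans hxy) hxy)
          have e : φ' y = h y * φ y := (div_mul_cancel₀ _ (hpos y).ne').symm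
          rw [e]
          exact mul_nonneg this (hpos y).le)
    have : φ x ≤ 0 := ge_of_tendsto hlim (by
      filter_upwards [eventually_ge_atTop x] with y hy
      exact hφmono Set.self_mem_Ici hy hy)
    exact this.not_gt (hpos x)
  refine ⟨?_, hg x hx⟩
  by_contra! hlt
  change -μ < h x at hlt
  have hd : 0 < μ ^ 2 - h x ^ 2 := by nlinarith [hneg x hx]
  have hgrow : MonotoneOn (fun y => h y - (μ ^ 2 - h x ^ 2) * y) (Set.Ici x) := by
    have hder' : ∀ y, HasDerivAt (fun y => h y - (μ ^ 2 - h x ^ 2) * y)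
        (V y + μ ^ 2 - h y ^ 2 - (μ ^ 2 - h x ^ 2)) y := fun y => by
      exact ((hder y).sub ((hasDerivAt_id y).const_mul (μ ^ 2 - h x ^ 2))).congr_deriv (by ring)
    refine monotoneOn_of_hasDerivWithinAt_nonneg (convex_Ici x)
      (fun y _ => (hder' y).continuousAt.continuousWithinAt)
      (fun y _ => (hder' y).hasDerivWithinAt) (fun y hy => ?_)
    have hxy : x ≤ y := interior_subset hy
    have h1 := hmono hx (hx.trans hxy) hxy
    have h2 := hneg y (hx.trans hxy)
    have h3 := hV0 y (hx.trans hxy)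
    nlinarith
  have hy : x ≤ x + -h x / (μ ^ 2 - h x ^ 2) := by
    have := div_pos (neg_pos.2 (hneg x hx)) hd
    linarith
  have h1 := hgrow Set.self_mem_Ici hy hy
  have h2 := hneg _ (hx.trans hy)
  have h3 : (μ ^ 2 - h x ^ 2) * (-h x / (μ ^ 2 - h x ^ 2)) = -h x := mul_div_cancel₀ _ hd.ne'
  simp only [mul_add] at h1
  linarith

/-- Two-sided bound for `h h'`, where `h` solves the Riccati equation `h' = V + μ² - h²`
with `h ≤ -μ` and `0 ≤ h'`. -/
lemma riccati_mul_deriv_bounds {h : ℝ → ℝ} {μ a : ℝ} (hμ1 : (0.808 : ℝ) ≤ μ)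
    (hμ2 : μ ≤ (0.883 : ℝ)) (ha : 0 < a) (hq : ∀ x, a ≤ x → Qt x < 0.49)
    (hconv : ∀ x, a ≤ x → 0 ≤ 27 * Qt x ^ 2 - 50 * Qt x + 18)
    (hder : ∀ x, HasDerivAt h (Vpot x + μ ^ 2 - h x ^ 2) x)
    (hle : ∀ x, a ≤ x → h x ≤ -μ) (hg : ∀ x, a ≤ x → 0 ≤ Vpot x + μ ^ 2 - h x ^ 2)
    {x : ℝ} (hx : a ≤ x) :
    deriv Vpot x ≤ h x * (Vpot x + μ ^ 2 - h x ^ 2) ∧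
      h x * (Vpot x + μ ^ 2 - h x ^ 2) ≤ 3 / 8 * deriv Vpot x := by
  set g := fun x => Vpot x + μ ^ 2 - h x ^ 2 with hgdef
  have hgder : ∀ x, HasDerivAt g (deriv Vpot x - 2 * h x * g x) x := fun x => by
    refine HasDerivAt.congr_deriv (((hasDerivAt_Vpot x).add_const (μ ^ 2)).sub ((hder x).pow 2)) ?_
    rw [deriv_Vpot]
    simp only [hgdef]
    norm_num
  have hPder : ∀ x, HasDerivAt (fun x => h x * g x)
      (g x ^ 2 + h x * (deriv Vpot x - 2 * h x * g x)) x := fun x => by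
    refine HasDerivAt.congr_deriv ((hder x).mul (hgder x)) ?_
    simp only [hgdef]
    ring
  have hVle : ∀ x, a ≤ x → Vpot x ≤ 1 / 4 := fun x hx => by
    have h1 := hq x hx
    have h2 := Qt_pos x
    unfold Vpot
    have h3 : 0 ≤ (1 / 2 - Qt x) * (1 / 4 + Qt x / 2 - Qt x ^ 2) :=
      mul_nonneg (by linarith) (by nlinarith)
    linarith
  have hglim : Tendsto g atTop (nhds 0) := by
    refine squeeze_zero' ?_ ?_ tendsto_Vpot
    · filter_upwards [eventually_ge_atTop a] with y hy using hg y hy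
    · filter_upwards [eventually_ge_atTop a] with y hy
      have := hle y hy
      simp only [hgdef]
      nlinarith
  have hhbdd : ∀ x, a ≤ x → |h x| ≤ 2 := fun x hx => by
    refine abs_le_of_sq_le_sq ?_ (by norm_num)
    have := hg x hx
    have := hVle x hx
    nlinarith
  have hPlim : Tendsto (fun x => h x * g x) atTop (nhds 0) := by
    have h2 : Tendsto (fun x => 2 * |g x|) atTop (nhds 0) := by
      simpa using hglim.abs.const_mul 2
    refine squeeze_zero_norm' ?_ h2
    filter_upwards [eventually_ge_atTop a] with y hy
    rw [Real.norm_eq_abs, abs_mul]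
    exact mul_le_mul_of_nonneg_right (hhbdd y hy) (abs_nonneg _)
  have hWpos : ∀ x, a ≤ x → 0 < -deriv Vpot x := fun x hx => by
    have h1 := hq x hx
    have h2 := Qt_pos x
    have h3 := Ht_pos (ha.trans_le hx)
    have h4 : 0 < 2 - 3 * Qt x := by linarith
    rw [deriv_Vpot, neg_neg]
    positivity
  have hgV : ∀ x, a ≤ x → g x ≤ Vpot x / 4 := by
    intro x hx
    have := nonneg_of_tendsto_zero_of_deriv_nonpos (a := a) (f := fun x => Vpot x / 4 - g x)
      (f' := fun x => deriv Vpot x / 4 - (deriv Vpot x - 2 * h x * g x))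
      (fun y _ => by
        have hv := hasDerivAt_Vpot y
        rw [← hv.deriv] at hv
        exact (hv.div_const 4).sub (hgder y))
      (fun y hy hlt => by
        have h1 := hq y hy
        have h2 := Qt_pos y
        have h3 := Ht_pos (ha.trans_le hy)
        have h4 : Ht y ≤ 1 := by nlinarith [sq_Ht y]
        have h5 := hle y hy
        have h6 : 0 < Vpot y := by
          unfold Vpot
          have : 0 < 1 - Qt y := by linarith
          positivity
        have h7 : h y * g y ≤ -0.808 * (Vpot y / 4) := by nlinarith
        have h8 : -deriv Vpot y ≤ 2 * Qt y ^ 3 * (2 - 3 * Qt y) := by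
          rw [deriv_Vpot]
          have : 0 < Qt y ^ 3 * (2 - 3 * Qt y) := mul_pos (by positivity) (by linarith)
          nlinarith
        have h9 : 3 / 2 * (2 * Qt y ^ 3 * (2 - 3 * Qt y)) ≤ 0.808 * Vpot y := by
          have : 0 ≤ Qt y ^ 2 * (1.616 - 7.616 * Qt y + 9 * Qt y ^ 2) :=
            mul_nonneg (by positivity) (by nlinarith [sq_nonneg (Qt y - 0.4231)])
          unfold Vpot
          linarith
        linarith)
      (by simpa using (tendsto_Vpot.div_const 4).sub hglim) hx
    linarith
  constructor
  · have := nonneg_of_tendsto_zero_of_deriv_nonpos (a := a)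
      (f := fun x => h x * g x - deriv Vpot x)
      (f' := fun x => g x ^ 2 + h x * (deriv Vpot x - 2 * h x * g x) -
        2 / 3 * Qt x ^ 4 * (27 * Qt x ^ 2 - 50 * Qt x + 18))
      (fun y _ => (hPder y).sub (hasDerivAt_deriv_Vpot y))
      (fun y hy hlt => by
        have h1 : 0 ≤ 2 / 3 * Qt y ^ 4 * (27 * Qt y ^ 2 - 50 * Qt y + 18) :=
          mul_nonneg (by positivity) (hconv y hy)
        have h2 := hg y hy
        change 0 ≤ g y at h2
        have h3 := hle y hy
        have h4 := hgV y hy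
        have h5 := hVle y hy
        have h6 : h y * (deriv Vpot y - h y * g y) ≤ 0 :=
          mul_nonpos_of_nonpos_of_nonneg (by linarith) (by linarith)
        have h7 : 0 ≤ g y * (h y ^ 2 - g y) := mul_nonneg h2 (by nlinarith)
        nlinarith)
      (by simpa using hPlim.sub tendsto_deriv_Vpot) hx
    linarith
  · have := nonneg_of_tendsto_zero_of_deriv_nonpos (a := a)
      (f := fun x => 3 / 8 * deriv Vpot x - h x * g x)
      (f' := fun x => 3 / 8 * (2 / 3 * Qt x ^ 4 * (27 * Qt x ^ 2 - 50 * Qt x + 18)) -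
        (g x ^ 2 + h x * (deriv Vpot x - 2 * h x * g x)))
      (fun y _ => ((hasDerivAt_deriv_Vpot y).const_mul (3 / 8)).sub (hPder y))
      (fun y hy hlt => by
        have h1 := hq y hy
        have h2 := Qt_pos y
        have h3 := Ht_pos (ha.trans_le hy)
        have h4 := hle y hy
        have h5 := hgV y hy
        have h6 : h y * (deriv Vpot y / 4) ≤ h y * (deriv Vpot y - 2 * h y * g y) :=
          mul_le_mul_of_nonpos_left (by linarith) (by linarith)
        have h7 : 0.748 ≤ -h y * Ht y := by
          have hk : 0.652864 + 3 / 4 * Vpot y ≤ h y ^ 2 := by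
            simp only [hgdef] at h5
            nlinarith
          have hpoly : 0.748 ^ 2 ≤ (0.652864 + 3 / 4 * Vpot y) * (1 - 2 / 3 * Qt y) := by
            unfold Vpot
            nlinarith [mul_nonneg (mul_pos h2 h2).le (sub_nonneg.2 h1.le)]
          refine (sq_le_sq₀ (by norm_num) (mul_nonneg (by linarith) h3.le)).1 ?_
          rw [mul_pow, neg_sq, sq_Ht]
          exact hpoly.trans (mul_le_mul_of_nonneg_right hk (by linarith))
        have h8 : Qt y * (36 - 100 * Qt y + 54 * Qt y ^ 2) ≤ 4 * 0.748 * (2 - 3 * Qt y) := by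
          nlinarith [mul_nonneg (show 0 ≤ 1.2599 - Qt y by linarith) (sq_nonneg (Qt y - 0.296))]
        have h9 : 0.748 * (2 - 3 * Qt y) ≤ -h y * Ht y * (2 - 3 * Qt y) :=
          mul_le_mul_of_nonneg_right h7 (by linarith)
        have h10 : 0 ≤ Qt y ^ 3 * (4 * (-h y * Ht y * (2 - 3 * Qt y)) -
            Qt y * (36 - 100 * Qt y + 54 * Qt y ^ 2)) := mul_nonneg (by positivity) (by linarith)
        have h11 : h y * (deriv Vpot y / 4) =
            -h y * Ht y * (2 - 3 * Qt y) * Qt y ^ 3 / 2 := by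
          rw [deriv_Vpot]
          ring
        linarith [sq_nonneg (g y)])
      (by simpa using (tendsto_deriv_Vpot.const_mul (3 / 8)).sub hPlim) hx
    linarith

/-- For `x ≥ x_{2,2}` (the largest zero of `V''` in `(0,∞)`) one
has `3V' ≤ V₀' ≤ (1/2)V'`; in particular `V₀' < 0` there, so `V₀'` decays at
the rate of `V'`. -/
theorem transformed_potential_derivative_decay (φ₀ : ℝ → ℝ) (μ₀ : ℝ)
    (hC2 : ContDiff ℝ 2 φ₀) (hpos : ∀ x : ℝ, 0 < φ₀ x)
    (heven : ∀ x : ℝ, φ₀ (-x) = φ₀ x)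
    (hL2 : Integrable (fun x => (φ₀ x)^2))
    (hμ1 : (0.808:ℝ) ≤ μ₀) (hμ2 : μ₀ ≤ (0.883:ℝ))
    (heq : ∀ x : ℝ, -(deriv (deriv φ₀) x) + Vpot x * φ₀ x = -μ₀^2 * φ₀ x)
    (hdecay : ∃ C > (0:ℝ), ∀ x : ℝ,
      |φ₀ x| + |deriv φ₀ x| ≤ C * Real.exp (-(Real.sqrt 2 / 2) * μ₀ * |x|))
    (x22 : ℝ) (hx22pos : 0 < x22)
    (hx22zero : deriv (deriv Vpot) x22 = 0)
    (hx22max : ∀ y : ℝ, 0 < y → deriv (deriv Vpot) y = 0 → y ≤ x22) :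
    ∀ x : ℝ, x22 ≤ x →
      3 * deriv Vpot x
          ≤ deriv (fun y => 2 * (deriv φ₀ y / φ₀ y)^2 - 2 * μ₀^2 - Vpot y) x ∧
      deriv (fun y => 2 * (deriv φ₀ y / φ₀ y)^2 - 2 * μ₀^2 - Vpot y) x
          ≤ (1/2) * deriv Vpot x ∧
      deriv (fun y => 2 * (deriv φ₀ y / φ₀ y)^2 - 2 * μ₀^2 - Vpot y) x < 0 := by
  have hφ : ∀ x, HasDerivAt φ₀ (deriv φ₀ x) x := fun x =>
    (hC2.differentiable (by norm_num) x).hasDerivAt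
  have hφ' : ∀ x, HasDerivAt (deriv φ₀) ((Vpot x + μ₀ ^ 2) * φ₀ x) x := fun x => by
    have hd : Differentiable ℝ (deriv φ₀) :=
      (ContDiff.iterate_deriv' 1 1 hC2).differentiable (by norm_num)
    refine HasDerivAt.congr_deriv ((hd x).hasDerivAt) ?_
    linarith [heq x]
  have hμ : 0 < μ₀ := by linarith
  obtain ⟨C, _, hC⟩ := hdecay
  have hexp : Tendsto (fun x : ℝ => C * Real.exp (-(Real.sqrt 2 / 2) * μ₀ * |x|)) atTop
      (nhds 0) := by
    have hc : -(Real.sqrt 2 / 2) * μ₀ < 0 := by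
      have : 0 < Real.sqrt 2 / 2 * μ₀ := by positivity
      linarith
    simpa using (Real.tendsto_exp_atBot.comp
      (tendsto_abs_atTop_atTop.const_mul_atTop_of_neg hc)).const_mul C
  have hlim : Tendsto φ₀ atTop (nhds 0) := squeeze_zero_norm
    (fun x => by linarith [hC x, abs_nonneg (deriv φ₀ x), Real.norm_eq_abs (φ₀ x)]) hexp
  have hlim' : Tendsto (deriv φ₀) atTop (nhds 0) := squeeze_zero_norm
    (fun x => by linarith [hC x, abs_nonneg (φ₀ x), Real.norm_eq_abs (deriv φ₀ x)]) hexp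
  obtain ⟨hroot, hsmall⟩ := Qt_largest_inflection hx22pos hx22zero hx22max
  have hanti : ∀ y, x22 ≤ y → Qt y ≤ Qt x22 := fun y hy =>
    Qt_antitoneOn hx22pos.le (hx22pos.le.trans hy) hy
  have hconv : ∀ y, x22 ≤ y → 0 ≤ 27 * Qt y ^ 2 - 50 * Qt y + 18 := fun y hy => by
    nlinarith [hanti y hy]
  have hV0 : ∀ y, x22 ≤ y → 0 ≤ Vpot y := fun y hy => by
    have : 0 < 1 - Qt y := by linarith [hanti y hy]
    unfold Vpot
    positivity
  have hV' : ∀ y, x22 ≤ y → deriv Vpot y < 0 := fun y hy => by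
    have h1 : 0 < 2 - 3 * Qt y := by linarith [hanti y hy]
    have h2 := Ht_pos (hx22pos.trans_le hy)
    have h3 := Qt_pos y
    rw [deriv_Vpot, neg_lt_zero]
    positivity
  have hbd := fun y (hy : x22 ≤ y) => log_deriv_bounds_of_decay hμ hφ hφ' hpos hlim hlim'
    (fun z => (hasDerivAt_Vpot z).differentiableAt.hasDerivAt) hV0 (fun z hz => (hV' z hz).le)
    tendsto_Vpot hy
  have hder : ∀ y, HasDerivAt (fun z => deriv φ₀ z / φ₀ z)
      (Vpot y + μ₀ ^ 2 - (deriv φ₀ y / φ₀ y) ^ 2) y := fun y => by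
    have hne := (hpos y).ne'
    refine HasDerivAt.congr_deriv ((hφ' y).div (hφ y) hne) ?_
    field_simp
  intro x hx
  obtain ⟨hlow, hup⟩ := riccati_mul_deriv_bounds (h := fun z => deriv φ₀ z / φ₀ z) hμ1 hμ2 hx22pos
    (fun y hy => (hanti y hy).trans_lt hsmall) hconv hder (fun y hy => (hbd y hy).1)
    (fun y hy => (hbd y hy).2) hx
  have hd : deriv (fun y => 2 * (deriv φ₀ y / φ₀ y) ^ 2 - 2 * μ₀ ^ 2 - Vpot y) x =
      4 * ((deriv φ₀ x / φ₀ x) * (Vpot x + μ₀ ^ 2 - (deriv φ₀ x / φ₀ x) ^ 2)) -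
        deriv Vpot x := by
    have h := ((((hder x).pow 2).const_mul 2).sub_const (2 * μ₀ ^ 2)).sub
      (hasDerivAt_Vpot x).differentiableAt.hasDerivAt
    refine HasDerivAt.deriv (h.congr_deriv ?_)
    norm_num
    ring
  rw [hd]
  have := hV' x hx
  refine ⟨?_, ?_, ?_⟩ <;> linarith
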